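/- arXiv:1410.3559 — 2 statements merged into one kernel-verified Lean document; each statement's English description precedes it below -/
import Mathlib

section
/- Let Ω ⊆ ℂ be a nonempty open connected set. If ∂̄ has closed range on L²_{0,1}(Ω), i.e. the set R(∂̄) = {f ∈ L²(Ω) : ∃u ∈ L²(Ω) with ∂̄u = f distributionally on Ω} is closed in L²(Ω), then Ω does not contain arbitrarily large discs: there exists L > 0 such that no open disc of radius L is contained in Ω (for every z ∈ ℂ, {w ∈ ℂ : |w − z| < L} ⊄ Ω). -/
open MeasureTheory Complex Metric Set

noncomputable section

/-- The Wirtinger derivative `∂φ/∂z̄(z) = (1/2)(Dφ_z(1) + i·Dφ_z(i))` of `φ : ℂ → ℂ`. -/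
def dbar1 (φ : ℂ → ℂ) (z : ℂ) : ℂ :=
  (1 / 2) * (fderiv ℝ φ z 1 + Complex.I * fderiv ℝ φ z Complex.I)

/-- A test function on `Ω ⊆ ℂ`: smooth with compact support contained in `Ω`. -/
def IsTest1 (Ω : Set ℂ) (φ : ℂ → ℂ) : Prop :=
  ContDiff ℝ (⊤ : ℕ∞) φ ∧ HasCompactSupport φ ∧ tsupport φ ⊆ Ω

/-- `∂̄u = f` distributionally on `Ω ⊆ ℂ`. -/
def DbarEq1 (Ω : Set ℂ) (u f : ℂ → ℂ) : Prop :=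
  ∀ φ : ℂ → ℂ, IsTest1 Ω φ → ∫ z in Ω, f z * φ z = - ∫ z in Ω, u z * dbar1 φ z

/-- Condition `𝒳` with constants `M, δ`: every `z ∈ Ω` has a point `w` with `|w − z| < M`
outside `closure Ω` whose distance to `closure Ω` exceeds `δ`. -/
def CondXWith (Ω : Set ℂ) (M δ : ℝ) : Prop :=
  ∀ z ∈ Ω, ∃ w : ℂ, dist w z < M ∧ w ∉ closure Ω ∧ δ < Metric.infDist w (closure Ω)

/-- Condition `𝒳`. -/
def CondX (Ω : Set ℂ) : Prop := ∃ M > 0, ∃ δ > 0, CondXWith Ω M δ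

/-- One quarter of the Laplacian, `φ_{zz̄}(z) = (1/4)(D²φ_z(1,1) + D²φ_z(i,i))`. -/
def lapQuarter (φ : ℂ → ℝ) (z : ℂ) : ℝ :=
  (1 / 4) * (iteratedFDeriv ℝ 2 φ z ![1, 1]
    + iteratedFDeriv ℝ 2 φ z ![Complex.I, Complex.I])

open scoped ComplexConjugate InnerProductSpace

section WirtingerCalculus

variable {φ ψ : ℂ → ℂ}

lemma contDiff_dbar1 (h : ContDiff ℝ (⊤ : ℕ∞) φ) : ContDiff ℝ (⊤ : ℕ∞) (dbar1 φ) := by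
  have h1 : ContDiff ℝ (⊤ : ℕ∞) (fderiv ℝ φ) := h.fderiv_right (by simp)
  unfold dbar1
  fun_prop

lemma support_dbar1_subset : Function.support (dbar1 φ) ⊆ tsupport φ := by
  intro z hz
  by_contra h
  refine hz ?_
  have : fderiv ℝ φ z = 0 := by
    by_contra h'
    exact h (support_fderiv_subset ℝ h')
  simp [dbar1, this]

lemma HasCompactSupport.dbar1 (h : HasCompactSupport φ) : HasCompactSupport (dbar1 φ) :=
  h.mono' support_dbar1_subset

lemma IsTest1.dbar1 {Ω : Set ℂ} (h : IsTest1 Ω φ) : IsTest1 Ω (dbar1 φ) :=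
  ⟨contDiff_dbar1 h.1, h.2.1.dbar1,
    (closure_minimal support_dbar1_subset (isClosed_tsupport φ)).trans h.2.2⟩

lemma IsTest1.conj {Ω : Set ℂ} (h : IsTest1 Ω φ) : IsTest1 Ω (fun z ↦ conj (φ z)) := by
  refine ⟨Complex.conjCLE.contDiff.comp h.1, h.2.1.comp_left (g := conj) (map_zero _), ?_⟩
  exact (closure_mono (Function.support_comp_subset (map_zero (starRingEnd ℂ)) φ)).trans h.2.2

lemma IsTest1.setIntegral_mul {Ω : Set ℂ} (h : IsTest1 Ω φ) (g : ℂ → ℂ) :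
    ∫ z in Ω, g z * φ z = ∫ z, g z * φ z := by
  refine setIntegral_eq_integral_of_forall_compl_eq_zero fun z hz ↦ ?_
  have : φ z = 0 := image_eq_zero_of_notMem_tsupport fun h' ↦ hz (h.2.2 h')
  simp [this]

lemma IsTest1.memLp {Ω : Set ℂ} (h : IsTest1 Ω φ) :
    MemLp φ 2 ((volume : Measure ℂ).restrict Ω) :=
  (h.1.continuous.memLp_of_hasCompactSupport h.2.1).restrict Ω

/-- Integration by parts for the Wirtinger derivative. -/
lemma integral_dbar1_mul (hψ : ContDiff ℝ (⊤ : ℕ∞) ψ) (hφ : ContDiff ℝ (⊤ : ℕ∞) φ)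
    (hc : HasCompactSupport φ) :
    ∫ z, dbar1 ψ z * φ z = - ∫ z, ψ z * dbar1 φ z := by
  have hψ' : Continuous (fderiv ℝ ψ) := hψ.continuous_fderiv (by simp)
  have hφ' : Continuous (fderiv ℝ φ) := hφ.continuous_fderiv (by simp)
  have c1 := hψ.continuous
  have c2 := hφ.continuous
  have i1 (v : ℂ) : Integrable (fun z ↦ fderiv ℝ ψ z v * φ z) :=
    (by fun_prop : Continuous _).integrable_of_hasCompactSupport hc.mul_left
  have i2 (v : ℂ) : Integrable (fun z ↦ ψ z * fderiv ℝ φ z v) :=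
    (by fun_prop : Continuous _).integrable_of_hasCompactSupport
      (HasCompactSupport.mul_left (hc.fderiv_apply ℝ v))
  have i3 : Integrable (fun z ↦ ψ z * φ z) :=
    (by fun_prop : Continuous _).integrable_of_hasCompactSupport hc.mul_left
  have key (v : ℂ) : ∫ z, ψ z * fderiv ℝ φ z v = - ∫ z, fderiv ℝ ψ z v * φ z :=
    integral_mul_fderiv_eq_neg_fderiv_mul_of_integrable (i1 v) (i2 v) i3
      (fun z _ ↦ hψ.differentiable (by simp) z) (fun z _ ↦ hφ.differentiable (by simp) z)
  have e1 : ∀ z, dbar1 ψ z * φ z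
      = (1 / 2) * (fderiv ℝ ψ z 1 * φ z) + (I / 2) * (fderiv ℝ ψ z I * φ z) := fun z ↦ by
    unfold dbar1; ring
  have e2 : ∀ z, ψ z * dbar1 φ z
      = (1 / 2) * (ψ z * fderiv ℝ φ z 1) + (I / 2) * (ψ z * fderiv ℝ φ z I) := fun z ↦ by
    unfold dbar1; ring
  simp_rw [e1, e2]
  rw [integral_add ((i1 1).const_mul _) ((i1 I).const_mul _),
    integral_add ((i2 1).const_mul _) ((i2 I).const_mul _)]
  simp_rw [integral_const_mul, key]
  ring

lemma IsTest1.dbarEq1 {Ω : Set ℂ} (h : IsTest1 Ω ψ) : DbarEq1 Ω ψ (_root_.dbar1 ψ) := by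
  intro φ hφ
  rw [hφ.setIntegral_mul, hφ.dbar1.setIntegral_mul, integral_dbar1_mul h.1 hφ.1 hφ.2.1]

lemma dbar1_comp_smul_sub (c : ℝ) (a z : ℂ) :
    dbar1 (fun w ↦ φ (c • (w - a))) z = c * dbar1 φ (c • (z - a)) := by
  have : fderiv ℝ (fun w ↦ φ (c • (w - a))) z = c • fderiv ℝ φ (c • (z - a)) := by
    rw [fderiv_comp_sub (f := fun w ↦ φ (c • w)), fderiv_comp_smul]
  rw [dbar1, dbar1, this]
  simp only [_root_.smul_apply, real_smul]
  ring

lemma dbar1_const_mul (hφ : Differentiable ℝ φ) (c z : ℂ) :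
    dbar1 (fun w ↦ c * φ w) z = c * dbar1 φ z := by
  simp only [dbar1, fderiv_const_mul (hφ z), _root_.smul_apply, smul_eq_mul]
  ring

lemma dbar1_ofReal_eq_zero_iff {b : ℂ → ℝ} (hb : Differentiable ℝ b) (z : ℂ) :
    dbar1 (fun w ↦ (b w : ℂ)) z = 0 ↔ fderiv ℝ b z = 0 := by
  have : fderiv ℝ (fun w ↦ (b w : ℂ)) z = ofRealCLM.comp (fderiv ℝ b z) :=
    (ofRealCLM.hasFDerivAt.comp z (hb z).hasFDerivAt).fderiv
  constructor
  · intro h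
    simp only [dbar1, this, ContinuousLinearMap.comp_apply, ofRealCLM_apply] at h
    have h1 := congrArg re h
    have h2 := congrArg im h
    simp at h1 h2
    ext w
    have hw : w = w.re • (1 : ℂ) + w.im • I := by simp
    rw [hw, map_add, map_smul, map_smul, h1, h2]
    simp
  · intro h
    simp [dbar1, this, h]

end WirtingerCalculus

section ClosedRange

variable {Ω : Set ℂ}

lemma inner_toLp_conj_eq_setIntegral {g : ℂ → ℂ}
    (hg : MemLp (fun z ↦ conj (g z)) 2 ((volume : Measure ℂ).restrict Ω))
    (u : Lp ℂ 2 ((volume : Measure ℂ).restrict Ω)) :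
    ⟪hg.toLp _, u⟫_ℂ = ∫ z in Ω, u z * g z := by
  rw [L2.inner_def]
  refine integral_congr_ae ?_
  filter_upwards [hg.coeFn_toLp] with z hz
  simp [hz]

lemma norm_toLp_sq_eq_setIntegral {g : ℂ → ℂ}
    (hg : MemLp g 2 ((volume : Measure ℂ).restrict Ω)) :
    ‖hg.toLp g‖ ^ 2 = ∫ z in Ω, ‖g z‖ ^ 2 := by
  rw [← ofReal_inj (z := ‖hg.toLp g‖ ^ 2), ofReal_pow]
  have h := inner_self_eq_norm_sq_to_K (𝕜 := ℂ) (hg.toLp g)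
  refine h.symm.trans ?_
  rw [L2.inner_def, ← integral_complex_ofReal]
  refine integral_congr_ae ?_
  filter_upwards [hg.coeFn_toLp] with z hz
  rw [hz, inner_self_eq_norm_sq_to_K]
  simp

/-- The graph of the weak (maximal) `∂̄`-operator on `L²(Ω)`, as a closed subspace. -/
lemma exists_isClosed_submodule_mem_iff_dbarEq1 (Ω : Set ℂ) :
    ∃ G : Submodule ℂ (Lp ℂ 2 ((volume : Measure ℂ).restrict Ω) ×
        Lp ℂ 2 ((volume : Measure ℂ).restrict Ω)),
      IsClosed (G : Set (Lp ℂ 2 ((volume : Measure ℂ).restrict Ω) ×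
        Lp ℂ 2 ((volume : Measure ℂ).restrict Ω))) ∧ ∀ p, p ∈ G ↔ DbarEq1 Ω p.1 p.2 := by
  let ℓ (φ : {φ : ℂ → ℂ // IsTest1 Ω φ}) :
      (Lp ℂ 2 ((volume : Measure ℂ).restrict Ω) ×
        Lp ℂ 2 ((volume : Measure ℂ).restrict Ω)) →L[ℂ] ℂ :=
    (innerSL ℂ (φ.2.dbar1.conj.memLp.toLp _)).coprod (innerSL ℂ (φ.2.conj.memLp.toLp _))
  refine ⟨⨅ φ, (ℓ φ).ker, ?_, fun p ↦ ?_⟩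
  · rw [Submodule.coe_iInf]
    exact isClosed_iInter fun φ ↦ (ℓ φ).isClosed_ker
  · simp only [Submodule.mem_iInf, LinearMap.mem_ker, Subtype.forall, DbarEq1]
    refine forall₂_congr fun φ hφ ↦ ?_
    have : ℓ ⟨φ, hφ⟩ p = (∫ z in Ω, p.1 z * dbar1 φ z) + ∫ z in Ω, p.2 z * φ z := by
      rw [← inner_toLp_conj_eq_setIntegral hφ.conj.memLp,
        ← inner_toLp_conj_eq_setIntegral hφ.dbar1.conj.memLp]
      simp [ℓ]
    rw [ContinuousLinearMap.coe_coe, this, add_comm, add_eq_zero_iff_eq_neg]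

lemma exists_dbarEq1_norm_le_of_isClosed
    (hcr : IsClosed {f : Lp ℂ 2 ((volume : Measure ℂ).restrict Ω) |
      ∃ u : Lp ℂ 2 ((volume : Measure ℂ).restrict Ω), DbarEq1 Ω (⇑u) (⇑f)}) :
    ∃ C : ℝ, ∀ u f : Lp ℂ 2 ((volume : Measure ℂ).restrict Ω), DbarEq1 Ω u f →
      ∃ v : Lp ℂ 2 ((volume : Measure ℂ).restrict Ω), DbarEq1 Ω v f ∧ ‖v‖ ≤ C * ‖f‖ := by
  obtain ⟨G, hG, hmem⟩ := exists_isClosed_submodule_mem_iff_dbarEq1 Ω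
  let T := (ContinuousLinearMap.snd ℂ (Lp ℂ 2 ((volume : Measure ℂ).restrict Ω))
    (Lp ℂ 2 ((volume : Measure ℂ).restrict Ω))).comp G.subtypeL
  have hT : (T.range : Set (Lp ℂ 2 ((volume : Measure ℂ).restrict Ω))) =
      {f : Lp ℂ 2 ((volume : Measure ℂ).restrict Ω) |
        ∃ u : Lp ℂ 2 ((volume : Measure ℂ).restrict Ω), DbarEq1 Ω (⇑u) (⇑f)} := by
    ext f
    constructor
    · rintro ⟨⟨p, hp⟩, rfl⟩
      exact ⟨p.1, (hmem p).1 hp⟩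
    · rintro ⟨u, hu⟩
      exact ⟨⟨(u, f), (hmem _).2 hu⟩, rfl⟩
  have : CompleteSpace G := hG.completeSpace_coe
  have : CompleteSpace T.range := by
    refine IsClosed.completeSpace_coe (hs := ?_)
    rw [← hT] at hcr
    exact hcr
  obtain ⟨C, -, hC⟩ := T.rangeRestrict.exists_preimage_norm_le T.surjective_rangeRestrict
  refine ⟨C, fun u f hu ↦ ?_⟩
  obtain ⟨⟨p, hp⟩, hpf, hle⟩ := hC ⟨f, ⟨(u, f), (hmem _).2 hu⟩, rfl⟩
  have hpf' : p.2 = f := congrArg Subtype.val hpf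
  exact ⟨p.1, hpf' ▸ (hmem p).1 hp, (norm_fst_le p).trans hle⟩

lemma DbarEq1.congr_ae {u u' f f' : ℂ → ℂ} (h : DbarEq1 Ω u f)
    (hu : u =ᵐ[(volume : Measure ℂ).restrict Ω] u')
    (hf : f =ᵐ[(volume : Measure ℂ).restrict Ω] f') : DbarEq1 Ω u' f' := by
  intro φ hφ
  have h1 : ∫ z in Ω, f' z * φ z = ∫ z in Ω, f z * φ z :=
    integral_congr_ae (hf.mono fun z hz ↦ by simp [hz])
  have h2 : ∫ z in Ω, u' z * dbar1 φ z = ∫ z in Ω, u z * dbar1 φ z :=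
    integral_congr_ae (hu.mono fun z hz ↦ by simp [hz])
  rw [h1, h2, h φ hφ]

/-- If `∂̄` has closed range, then the functions `conj (∂̄η) = ∂(conj η)`, which are orthogonal to
the kernel of `∂̄`, are controlled by their `∂̄`-derivative. -/
lemma exists_setIntegral_dbar1_le_of_isClosed
    (hcr : IsClosed {f : Lp ℂ 2 ((volume : Measure ℂ).restrict Ω) |
      ∃ u : Lp ℂ 2 ((volume : Measure ℂ).restrict Ω), DbarEq1 Ω (⇑u) (⇑f)}) :
    ∃ C : ℝ, ∀ η : ℂ → ℂ, IsTest1 Ω η →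
      ∫ z in Ω, ‖dbar1 η z‖ ^ 2 ≤ C * ∫ z in Ω, ‖dbar1 (fun w ↦ conj (dbar1 η w)) z‖ ^ 2 := by
  obtain ⟨C, hC⟩ := exists_dbarEq1_norm_le_of_isClosed hcr
  refine ⟨C ^ 2, fun η hη ↦ ?_⟩
  have hψ := hη.dbar1.conj
  set Ψ := hψ.memLp.toLp _
  have hΨf : DbarEq1 Ω Ψ (hψ.dbar1.memLp.toLp _) :=
    hψ.dbarEq1.congr_ae hψ.memLp.coeFn_toLp.symm hψ.dbar1.memLp.coeFn_toLp.symm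
  obtain ⟨v, hv, hle⟩ := hC _ _ hΨf
  have hinner : ⟪Ψ, v⟫_ℂ = ⟪Ψ, Ψ⟫_ℂ := by
    rw [inner_toLp_conj_eq_setIntegral, inner_toLp_conj_eq_setIntegral]
    exact neg_injective ((hv η hη).symm.trans (hΨf η hη))
  have hΨv : ‖Ψ‖ ≤ ‖v‖ := by
    have h1 : ‖Ψ‖ * ‖Ψ‖ ≤ ‖Ψ‖ * ‖v‖ := by
      have h := norm_inner_le_norm (𝕜 := ℂ) Ψ v
      rw [hinner, inner_self_eq_norm_sq_to_K] at h
      simpa [sq] using h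
    rcases (norm_nonneg Ψ).eq_or_lt with h0 | h0
    · exact h0 ▸ norm_nonneg v
    · exact le_of_mul_le_mul_left h1 h0
  have h2 : ‖Ψ‖ ^ 2 ≤ (C * ‖hψ.dbar1.memLp.toLp _‖) ^ 2 :=
    pow_le_pow_left₀ (norm_nonneg _) (hΨv.trans hle) 2
  rw [mul_pow, norm_toLp_sq_eq_setIntegral, norm_toLp_sq_eq_setIntegral] at h2
  simpa using h2

end ClosedRange

/-- A smooth function supported in the unit disc whose `∂̄`-derivative does not vanish. -/
lemma exists_isTest1_ball_integral_dbar1_pos :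
    ∃ η : ℂ → ℂ, IsTest1 (ball 0 1) η ∧ 0 < ∫ z, ‖dbar1 η z‖ ^ 2 := by
  let b : ContDiffBump (0 : ℂ) := ⟨1 / 4, 1 / 2, by norm_num, by norm_num⟩
  have hb : ContDiff ℝ (⊤ : ℕ∞) b := b.contDiff
  have hη : IsTest1 (ball 0 1) (fun z ↦ (b z : ℂ)) := by
    refine ⟨ofRealCLM.contDiff.comp hb, b.hasCompactSupport.comp_left ofReal_zero, ?_⟩
    refine (closure_mono (Function.support_comp_subset ofReal_zero b)).trans ?_
    refine b.tsupport_eq.subset.trans (closedBall_subset_ball ?_)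
    change (1 / 2 : ℝ) < 1
    norm_num
  refine ⟨_, hη, ?_⟩
  have hd := hb.differentiable (by simp)
  obtain ⟨z, hz⟩ : ∃ z, dbar1 (fun w ↦ (b w : ℂ)) z ≠ 0 := by
    by_contra! h
    have h01 := is_const_of_fderiv_eq_zero hd
      (fun z ↦ (dbar1_ofReal_eq_zero_iff hd z).1 (h z)) 0 1
    have h0 : b 0 = 1 := b.one_of_mem_closedBall (mem_closedBall_self b.rIn_pos.le)
    have h1 : b 1 = 0 := b.zero_of_le_dist (by simp [b]; norm_num)
    rw [h0, h1] at h01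
    exact one_ne_zero h01
  have hc : Continuous fun z ↦ ‖dbar1 (fun w ↦ (b w : ℂ)) z‖ ^ 2 :=
    hη.dbar1.1.continuous.norm.pow 2
  refine hc.integral_pos_of_hasCompactSupport_nonneg_nonzero ?_ (fun z ↦ by positivity)
    (x := z) (by simpa using hz)
  exact hη.dbar1.2.1.comp_left (g := fun w ↦ ‖w‖ ^ 2) (by simp)

lemma IsTest1.comp_smul_sub {η : ℂ → ℂ} (h : IsTest1 (ball 0 1) η) {L : ℝ} (hL : 0 < L)
    {a : ℂ} {Ω : Set ℂ} (hΩ : ball a L ⊆ Ω) :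
    IsTest1 Ω (fun w ↦ η (L⁻¹ • (w - a))) := by
  let e : ℂ ≃ₜ ℂ := (Homeomorph.subRight a).trans (Homeomorph.smulOfNeZero L⁻¹ (inv_ne_zero hL.ne'))
  refine ⟨h.1.comp (by fun_prop), h.2.1.comp_homeomorph e, ?_⟩
  have : tsupport (η ∘ e) ⊆ e ⁻¹' tsupport η := tsupport_comp_subset_preimage η e.continuous
  intro w hw
  have := h.2.2 (this hw)
  apply hΩ
  simp only [e, Homeomorph.trans_apply, mem_ball_zero_iff] at this
  change ‖L⁻¹ • (w - a)‖ < 1 at this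
  rw [norm_smul, norm_inv, Real.norm_of_nonneg hL.le, inv_mul_lt_iff₀ hL, mul_one] at this
  rwa [mem_ball, dist_eq_norm]

lemma integral_comp_smul_sub (g : ℂ → ℝ) (L : ℝ) (a : ℂ) :
    ∫ w, g (L⁻¹ • (w - a)) = L ^ 2 * ∫ w, g w := by
  rw [integral_sub_right_eq_self (fun w ↦ g (L⁻¹ • w)) a, Measure.integral_comp_inv_smul]
  simp [finrank_real_complex]

lemma IsTest1.setIntegral_norm_sq {Ω : Set ℂ} {φ : ℂ → ℂ} (h : IsTest1 Ω φ) :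
    ∫ z in Ω, ‖φ z‖ ^ 2 = ∫ z, ‖φ z‖ ^ 2 := by
  refine setIntegral_eq_integral_of_forall_compl_eq_zero fun z hz ↦ ?_
  have : φ z = 0 := image_eq_zero_of_notMem_tsupport fun h' ↦ hz (h.2.2 h')
  simp [this]

/-- **Large discs obstruct closed range.** Let `Ω ⊆ ℂ` be a domain. If `∂̄` has closed range
on `L²_{0,1}(Ω)`, then `Ω` does not contain arbitrarily large discs: there is `L > 0` such
that no open disc of radius `L` is contained in `Ω`. -/
theorem not_arbitrarily_large_discs_of_closed_range
    (Ω : Set ℂ) (hne : Ω.Nonempty) (hop : IsOpen Ω) (hconn : IsConnected Ω)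
    (hcr : IsClosed {f : Lp ℂ 2 ((volume : Measure ℂ).restrict Ω) |
      ∃ u : Lp ℂ 2 ((volume : Measure ℂ).restrict Ω), DbarEq1 Ω (⇑u) (⇑f)}) :
    ∃ L > 0, ∀ z : ℂ, ¬ Metric.ball z L ⊆ Ω := by
  obtain ⟨C, hC⟩ := exists_setIntegral_dbar1_le_of_isClosed hcr
  obtain ⟨η, hη, hA⟩ := exists_isTest1_ball_integral_dbar1_pos
  set A := ∫ z, ‖dbar1 η z‖ ^ 2 with hAdef
  set B := ∫ z, ‖dbar1 (fun w ↦ conj (dbar1 η w)) z‖ ^ 2 with hBdef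
  by_contra! hdisc
  set L : ℝ := |C * B / A| + 1 with hLdef
  have hL1 : 1 ≤ L := by simp [hLdef]
  have hL : 0 < L := by linarith
  obtain ⟨a, ha⟩ := hdisc L hL
  have hζ := hη.comp_smul_sub hL ha
  have key := hC _ hζ
  have e1 (z : ℂ) : dbar1 (fun w ↦ η (L⁻¹ • (w - a))) z = (L⁻¹ : ℝ) * dbar1 η (L⁻¹ • (z - a)) :=
    dbar1_comp_smul_sub _ _ _
  have e2 (z : ℂ) : dbar1 (fun w ↦ conj (dbar1 (fun w ↦ η (L⁻¹ • (w - a))) w)) z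
      = (L⁻¹ : ℝ) * ((L⁻¹ : ℝ) * dbar1 (fun w ↦ conj (dbar1 η w)) (L⁻¹ • (z - a))) := by
    simp only [e1, map_mul, conj_ofReal]
    rw [dbar1_const_mul, dbar1_comp_smul_sub (φ := fun w ↦ conj (dbar1 η w))]
    exact (hη.dbar1.conj.1.differentiable (by simp)).comp (by fun_prop)
  rw [hζ.dbar1.setIntegral_norm_sq, hζ.dbar1.conj.dbar1.setIntegral_norm_sq] at key
  simp only [e2] at key
  simp only [e1, norm_mul, mul_pow, norm_real, integral_const_mul] at key
  rw [integral_comp_smul_sub (fun w ↦ ‖dbar1 η w‖ ^ 2),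
    integral_comp_smul_sub (fun w ↦ ‖dbar1 (fun w ↦ conj (dbar1 η w)) w‖ ^ 2),
    ← hAdef, ← hBdef, Real.norm_of_nonneg (inv_nonneg.2 hL.le)] at key
  have h1 : A * L ^ 2 ≤ C * B := by
    have := mul_le_mul_of_nonneg_right key (sq_nonneg L)
    field_simp at this
    linarith
  have h2 : L ^ 2 ≤ C * B / A := by rw [le_div_iff₀ hA]; linarith
  have h3 : C * B / A < L := by
    rw [hLdef]
    linarith [le_abs_self (C * B / A)]
  nlinarith
end
end

section
/- Let D ⊆ ℂ be a nonempty open connected set which contains arbitrarily large discs: for every L > 0 there exists z ∈ ℂ with {w ∈ ℂ : |w − z| < L} ⊆ D. Let m ≥ 1 and set Ω := {(z, w) ∈ ℂ × ℂ^m : z ∈ D and |w| < 1} ⊆ ℂ^{m+1}, where |w| is the Euclidean norm of w. Then ∂̄ does not have closed range on L²_{0,1}(Ω): the set R(∂̄) = {α ∈ (L²(Ω))^{m+1} : ∃u ∈ L²(Ω) with ∂̄u = α distributionally on Ω} is not closed in (L²(Ω))^{m+1}. -/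
open MeasureTheory Complex Metric Set

noncomputable section

/-- The Wirtinger derivative `∂φ/∂z̄_j` of `φ : ℂⁿ → ℂ`:
`(1/2)(Dφ_z(e_j) + i·Dφ_z(i·e_j))`. -/
def dbarCoord (n : ℕ) (φ : (Fin n → ℂ) → ℂ) (j : Fin n) (z : Fin n → ℂ) : ℂ :=
  (1 / 2) * (fderiv ℝ φ z (Pi.single j 1) + Complex.I * fderiv ℝ φ z (Pi.single j Complex.I))

/-- A test function on `Ω`: smooth with compact support contained in `Ω`. -/
def IsTest (n : ℕ) (Ω : Set (Fin n → ℂ)) (φ : (Fin n → ℂ) → ℂ) : Prop :=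
  ContDiff ℝ (⊤ : ℕ∞) φ ∧ HasCompactSupport φ ∧ tsupport φ ⊆ Ω

/-- `∂̄u = α` distributionally on `Ω`. -/
def DbarEq (n : ℕ) (Ω : Set (Fin n → ℂ)) (u : (Fin n → ℂ) → ℂ)
    (α : Fin n → (Fin n → ℂ) → ℂ) : Prop :=
  ∀ j : Fin n, ∀ φ : (Fin n → ℂ) → ℂ, IsTest n Ω φ →
    ∫ z in Ω, α j z * φ z = - ∫ z in Ω, u z * dbarCoord n φ j z

/-- `α` is `∂̄`-closed on `Ω`. -/
def DbarClosed (n : ℕ) (Ω : Set (Fin n → ℂ)) (α : Fin n → (Fin n → ℂ) → ℂ) : Prop :=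
  ∀ j k : Fin n, ∀ φ : (Fin n → ℂ) → ℂ, IsTest n Ω φ →
    ∫ z in Ω, α j z * dbarCoord n φ k z = ∫ z in Ω, α k z * dbarCoord n φ j z

/-- The complex Hessian `Hf(z;ξ) = (1/4)(D²f_z(ξ,ξ) + D²f_z(iξ,iξ))`. -/
def hessC (n : ℕ) (f : (Fin n → ℂ) → ℝ) (z ξ : Fin n → ℂ) : ℝ :=
  (1 / 4) * (iteratedFDeriv ℝ 2 f z ![ξ, ξ]
    + iteratedFDeriv ℝ 2 f z ![Complex.I • ξ, Complex.I • ξ])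

/-- The pairing `⟨∂f(z), ξ⟩ = (1/2)(Df_z(ξ) − i·Df_z(iξ))`. -/
def delPair (n : ℕ) (f : (Fin n → ℂ) → ℝ) (z ξ : Fin n → ℂ) : ℂ :=
  (1 / 2) * ((fderiv ℝ f z ξ : ℂ) - Complex.I * (fderiv ℝ f z (Complex.I • ξ) : ℂ))

/-- Squared Euclidean norm of `ξ ∈ ℂⁿ`. -/
def enormSq (n : ℕ) (ξ : Fin n → ℂ) : ℝ := ∑ j, Complex.normSq (ξ j)

/-- The twisted curvature expression
`Θ_{λ,τ}(z;ξ) = τ(z)·Hλ(z;ξ) − Hτ(z;ξ) − τ(z)⁻¹·|⟨∂τ(z),ξ⟩|²`. -/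
def Theta (n : ℕ) (lam tau : (Fin n → ℂ) → ℝ) (z ξ : Fin n → ℂ) : ℝ :=
  tau z * hessC n lam z ξ - hessC n tau z ξ - (tau z)⁻¹ * Complex.normSq (delPair n tau z ξ)

/-- `Φ` is an exhaustion function of `Ω`: every sublevel set has compact closure inside `Ω`. -/
def ExhaustsOn (n : ℕ) (Ω : Set (Fin n → ℂ)) (Φ : (Fin n → ℂ) → ℝ) : Prop :=
  ∀ c : ℝ, IsCompact (closure {z ∈ Ω | Φ z < c}) ∧ closure {z ∈ Ω | Φ z < c} ⊆ Ω

/-- `Ω` is pseudoconvex: it admits a smooth plurisubharmonic exhaustion function. -/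
def Pseudoconvex (n : ℕ) (Ω : Set (Fin n → ℂ)) : Prop :=
  ∃ Φ : (Fin n → ℂ) → ℝ, ContDiffOn ℝ (⊤ : ℕ∞) Φ Ω ∧ (∀ z ∈ Ω, ∀ ξ, 0 ≤ hessC n Φ z ξ) ∧
    ExhaustsOn n Ω Φ

/-- `r` is a smooth defining function for `Ω` which is Levi pseudoconvex. -/
def IsLeviDefiningFn (n : ℕ) (Ω : Set (Fin n → ℂ)) (r : (Fin n → ℂ) → ℝ) : Prop :=
  ContDiff ℝ (⊤ : ℕ∞) r ∧ Ω = {z | r z < 0} ∧ (∀ z, r z = 0 → fderiv ℝ r z ≠ 0) ∧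
    (∀ p, r p = 0 → ∀ ξ, delPair n r p ξ = 0 → 0 ≤ hessC n r p ξ)

open scoped ContDiff InnerProductSpace

lemma continuous_dbarCoord {n : ℕ} {φ : (Fin n → ℂ) → ℂ} (hφ : ContDiff ℝ ∞ φ) (j : Fin n) :
    Continuous (dbarCoord n φ j) := by
  have h := hφ.continuous_fderiv (by simp)
  unfold dbarCoord
  fun_prop

lemma hasCompactSupport_dbarCoord {n : ℕ} {φ : (Fin n → ℂ) → ℂ} (hφ : HasCompactSupport φ)
    (j : Fin n) : HasCompactSupport (dbarCoord n φ j) := by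
  have h := fun v => hφ.fderiv_apply (𝕜 := ℝ) v
  exact ((h _).add ((h _).mul_left (f := fun _ => Complex.I))).mul_left (f := fun _ => (1 / 2 : ℂ))

lemma tsupport_dbarCoord_subset {n : ℕ} (φ : (Fin n → ℂ) → ℂ) (j : Fin n) :
    tsupport (dbarCoord n φ j) ⊆ tsupport φ := by
  refine closure_minimal (fun p hp => ?_) (isClosed_tsupport φ)
  by_contra hq
  have h : fderiv ℝ φ p = 0 :=
    image_eq_zero_of_notMem_tsupport fun h => hq (tsupport_fderiv_subset ℝ h)
  exact hp (by simp [dbarCoord, h])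

/-- Integration by parts for the Wirtinger derivative of a smooth function. -/
lemma dbarEq_of_contDiff {n : ℕ} (Ω : Set (Fin n → ℂ)) {u : (Fin n → ℂ) → ℂ}
    (hu : ContDiff ℝ ∞ u) : DbarEq n Ω u (dbarCoord n u) := by
  rintro j φ ⟨hφ, hc, hs⟩
  rw [setIntegral_eq_integral_of_forall_compl_eq_zero fun p hp => by
      rw [image_eq_zero_of_notMem_tsupport fun h => hp (hs h), mul_zero],
    setIntegral_eq_integral_of_forall_compl_eq_zero fun p hp => by
      rw [image_eq_zero_of_notMem_tsupport fun h => hp (hs (tsupport_dbarCoord_subset φ j h)),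
        mul_zero]]
  have cu := hu.continuous_fderiv (by simp)
  have cφ := hφ.continuous_fderiv (by simp)
  have cu0 := hu.continuous
  have cφ0 := hφ.continuous
  have i1 (v : Fin n → ℂ) : Integrable fun p => fderiv ℝ u p v * φ p :=
    Continuous.integrable_of_hasCompactSupport (by fun_prop) hc.mul_left
  have i2 (v : Fin n → ℂ) : Integrable fun p => u p * fderiv ℝ φ p v :=
    Continuous.integrable_of_hasCompactSupport (by fun_prop) (hc.fderiv_apply (𝕜 := ℝ) v).mul_left
  have i3 : Integrable fun p => u p * φ p :=
    Continuous.integrable_of_hasCompactSupport (by fun_prop) hc.mul_left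
  have key (v : Fin n → ℂ) :
      ∫ p, fderiv ℝ u p v * φ p = - ∫ p, u p * fderiv ℝ φ p v := by
    rw [integral_mul_fderiv_eq_neg_fderiv_mul_of_integrable (i1 v) (i2 v) i3
      (fun x _ => (hu.differentiable (by simp)) x) (fun x _ => (hφ.differentiable (by simp)) x),
      neg_neg]
  have e1 : (fun p => dbarCoord n u j p * φ p) = fun p =>
      (1 / 2 : ℂ) * (fderiv ℝ u p (Pi.single j 1) * φ p)
        + (1 / 2 * Complex.I) * (fderiv ℝ u p (Pi.single j Complex.I) * φ p) := by
    ext p; simp only [dbarCoord]; ring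
  have e2 : (fun p => u p * dbarCoord n φ j p) = fun p =>
      (1 / 2 : ℂ) * (u p * fderiv ℝ φ p (Pi.single j 1))
        + (1 / 2 * Complex.I) * (u p * fderiv ℝ φ p (Pi.single j Complex.I)) := by
    ext p; simp only [dbarCoord]; ring
  rw [e1, e2, integral_add ((i1 _).const_mul _) ((i1 _).const_mul _),
    integral_add ((i2 _).const_mul _) ((i2 _).const_mul _), integral_const_mul,
    integral_const_mul, integral_const_mul, integral_const_mul, key, key]
  ring

/-- `∂̄u = α` only depends on the almost everywhere classes of `u` and `α`. -/
lemma DbarEq.congr_ae {n : ℕ} {Ω : Set (Fin n → ℂ)} {u v : (Fin n → ℂ) → ℂ}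
    {α β : Fin n → (Fin n → ℂ) → ℂ} (h : DbarEq n Ω u α) (huv : u =ᵐ[volume.restrict Ω] v)
    (hαβ : ∀ j, α j =ᵐ[volume.restrict Ω] β j) : DbarEq n Ω v β := by
  intro j φ hφ
  have h1 : ∫ z in Ω, β j z * φ z = ∫ z in Ω, α j z * φ z :=
    integral_congr_ae (by filter_upwards [hαβ j] with z hz; rw [hz])
  have h2 : ∫ z in Ω, v z * dbarCoord n φ j z = ∫ z in Ω, u z * dbarCoord n φ j z :=
    integral_congr_ae (by filter_upwards [huv] with z hz; rw [hz])
  rw [h1, h2, h j φ hφ]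

/-- The bounded linear functional `f ↦ ∫ f g` on `L²` given by `g ∈ L²`. -/
def pairingCLM {X : Type*} [MeasurableSpace X] {μ : Measure X} {g : X → ℂ} (hg : MemLp g 2 μ) :
    Lp ℂ 2 μ →L[ℂ] ℂ :=
  innerSL ℂ (hg.star.toLp (star g))

lemma pairingCLM_apply {X : Type*} [MeasurableSpace X] {μ : Measure X} {g : X → ℂ}
    (hg : MemLp g 2 μ) (f : Lp ℂ 2 μ) : pairingCLM hg f = ∫ x, f x * g x ∂μ := by
  rw [pairingCLM, innerSL_apply_apply, L2.inner_def]
  refine integral_congr_ae ?_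
  filter_upwards [hg.star.coeFn_toLp] with x hx
  simp [hx]

lemma norm_integral_mul_le {X : Type*} [MeasurableSpace X] {μ : Measure X} {g : X → ℂ}
    (hg : MemLp g 2 μ) (f : Lp ℂ 2 μ) :
    ‖∫ x, f x * g x ∂μ‖ ≤ ‖f‖ * (eLpNorm g 2 μ).toReal := by
  rw [← pairingCLM_apply hg, pairingCLM, innerSL_apply_apply, mul_comm]
  refine (norm_inner_le_norm _ _).trans (le_of_eq ?_)
  rw [Lp.norm_toLp]
  congr 2
  exact eLpNorm_congr_norm_ae (by simp)

lemma IsTest.memLp {n : ℕ} {Ω : Set (Fin n → ℂ)} {φ : (Fin n → ℂ) → ℂ} (hφ : IsTest n Ω φ) :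
    MemLp φ 2 (volume.restrict Ω) :=
  (hφ.1.continuous.memLp_of_hasCompactSupport hφ.2.1).restrict Ω

lemma IsTest.memLp_dbarCoord {n : ℕ} {Ω : Set (Fin n → ℂ)} {φ : (Fin n → ℂ) → ℂ}
    (hφ : IsTest n Ω φ) (j : Fin n) : MemLp (dbarCoord n φ j) 2 (volume.restrict Ω) :=
  ((continuous_dbarCoord hφ.1 j).memLp_of_hasCompactSupport
    (hasCompactSupport_dbarCoord hφ.2.1 j)).restrict Ω

/-- The graph of the weak `∂̄` operator from `L²(Ω)` to `(L²(Ω))ⁿ`. -/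
def dbarGraph (n : ℕ) (Ω : Set (Fin n → ℂ)) :
    Submodule ℂ (Lp ℂ 2 (volume.restrict Ω) × (Fin n → Lp ℂ 2 (volume.restrict Ω))) :=
  ⨅ (j : Fin n) (φ : {φ : (Fin n → ℂ) → ℂ // IsTest n Ω φ}),
    (((pairingCLM φ.2.memLp).comp
        ((ContinuousLinearMap.proj (R := ℂ) j).comp (ContinuousLinearMap.snd ℂ _ _))) +
      (pairingCLM (φ.2.memLp_dbarCoord j)).comp (ContinuousLinearMap.fst ℂ _ _)).ker

lemma mem_dbarGraph {n : ℕ} {Ω : Set (Fin n → ℂ)}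
    {x : Lp ℂ 2 (volume.restrict Ω) × (Fin n → Lp ℂ 2 (volume.restrict Ω))} :
    x ∈ dbarGraph n Ω ↔ DbarEq n Ω x.1 (fun j => x.2 j) := by
  simp only [dbarGraph, Submodule.mem_iInf, Subtype.forall, DbarEq]
  refine forall_congr' fun j => forall_congr' fun φ => forall_congr' fun hφ => ?_
  simp [pairingCLM_apply, eq_neg_iff_add_eq_zero]

lemma isClosed_dbarGraph (n : ℕ) (Ω : Set (Fin n → ℂ)) :
    IsClosed (dbarGraph n Ω : Set
      (Lp ℂ 2 (volume.restrict Ω) × (Fin n → Lp ℂ 2 (volume.restrict Ω)))) := by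
  simp only [dbarGraph, Submodule.coe_iInf]
  exact isClosed_iInter fun j => isClosed_iInter fun φ => ContinuousLinearMap.isClosed_ker _

/-- If the weak `∂̄` operator has closed range, then `∂̄u = α` can be solved with an `L²` bound. -/
lemma exists_norm_le_of_isClosed_range {n : ℕ} {Ω : Set (Fin n → ℂ)}
    (h : IsClosed {α : Fin n → Lp ℂ 2 (volume.restrict Ω) |
      ∃ u : Lp ℂ 2 (volume.restrict Ω), DbarEq n Ω u (fun j => α j)}) :
    ∃ C > 0, ∀ (u : Lp ℂ 2 (volume.restrict Ω)) (α : Fin n → Lp ℂ 2 (volume.restrict Ω)),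
      DbarEq n Ω u (fun j => α j) →
      ∃ v : Lp ℂ 2 (volume.restrict Ω), DbarEq n Ω v (fun j => α j) ∧ ‖v‖ ≤ C * ‖α‖ := by
  let T : dbarGraph n Ω →L[ℂ] (Fin n → Lp ℂ 2 (volume.restrict Ω)) :=
    (ContinuousLinearMap.snd ℂ _ _).comp (dbarGraph n Ω).subtypeL
  have hr : (T.range : Set (Fin n → Lp ℂ 2 (volume.restrict Ω))) = {α |
      ∃ u : Lp ℂ 2 (volume.restrict Ω), DbarEq n Ω u (fun j => α j)} := by
    ext α
    constructor
    · rintro ⟨⟨x, hx⟩, rfl⟩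
      exact ⟨x.1, mem_dbarGraph.1 hx⟩
    · rintro ⟨u, hu⟩
      exact ⟨⟨(u, α), mem_dbarGraph.2 hu⟩, rfl⟩
  have : CompleteSpace (dbarGraph n Ω) := (isClosed_dbarGraph n Ω).completeSpace_coe
  have : CompleteSpace T.range := (hr.symm ▸ h : IsClosed
    (T.range : Set (Fin n → Lp ℂ 2 (volume.restrict Ω)))).completeSpace_coe
  obtain ⟨C, hC, H⟩ := T.rangeRestrict.exists_preimage_norm_le
    (LinearMap.surjective_rangeRestrict _)
  refine ⟨C, hC, fun u α hu => ?_⟩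
  obtain ⟨⟨x, hx⟩, hxα, hxC⟩ := H ⟨α, ⟨⟨(u, α), mem_dbarGraph.2 hu⟩, rfl⟩⟩
  have hx2 : x.2 = α := congrArg Subtype.val hxα
  refine ⟨x.1, hx2 ▸ mem_dbarGraph.1 hx, (norm_fst_le x).trans hxC⟩

/-- The one-variable Wirtinger derivative `∂q/∂z̄`. -/
def wirtingerBar (q : ℂ → ℂ) (ζ : ℂ) : ℂ :=
  (1 / 2) * (fderiv ℝ q ζ 1 + Complex.I * fderiv ℝ q ζ Complex.I)

lemma exists_norm_wirtingerBar_le {q : ℂ → ℂ} (hq : ContDiff ℝ ∞ q) (hc : HasCompactSupport q) :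
    ∃ M, ∀ ζ, ‖wirtingerBar q ζ‖ ≤ M := by
  have h := fun v => hc.fderiv_apply (𝕜 := ℝ) v
  have hd := hq.continuous_fderiv (by simp)
  refine HasCompactSupport.exists_bound_of_continuous
    (((h _).add ((h _).mul_left (f := fun _ => Complex.I))).mul_left (f := fun _ => (1 / 2 : ℂ)))
    ?_
  change Continuous fun ζ => (1 / 2 : ℂ) * (fderiv ℝ q ζ 1 + Complex.I * fderiv ℝ q ζ Complex.I)
  fun_prop

lemma wirtingerBar_eq_zero {q : ℂ → ℂ} {ζ : ℂ} (h : ζ ∉ tsupport q) : wirtingerBar q ζ = 0 := by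
  have h : fderiv ℝ q ζ = 0 :=
    image_eq_zero_of_notMem_tsupport fun h' => h (tsupport_fderiv_subset ℝ h')
  simp [wirtingerBar, h]

lemma wirtingerBar_eq_one {q : ℂ → ℂ} {ζ : ℂ} (h : q =ᶠ[nhds ζ] fun z => star z) :
    wirtingerBar q ζ = 1 := by
  have h1 : fderiv ℝ q ζ = (Complex.conjCLE : ℂ →L[ℝ] ℂ) := by
    rw [h.fderiv_eq]
    exact Complex.conjCLE.fderiv
  rw [wirtingerBar, h1]
  simp
  norm_num

/-- The derivative of a rescaled function of the first coordinate times a function of the others. -/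
lemma fderiv_scaled_mul_tail {m : ℕ} {q : ℂ → ℂ} (hq : Differentiable ℝ q)
    {b : (Fin m → ℂ) → ℂ} (hb : Differentiable ℝ b) (z₀ : ℂ) (L : ℝ) (p v : Fin (m + 1) → ℂ) :
    fderiv ℝ (fun p : Fin (m + 1) → ℂ => q (L⁻¹ • (p 0 - z₀)) * b (fun j => p j.succ)) p v =
      L⁻¹ • fderiv ℝ q (L⁻¹ • (p 0 - z₀)) (v 0) * b (fun j => p j.succ) +
      q (L⁻¹ • (p 0 - z₀)) * fderiv ℝ b (fun j => p j.succ) (fun j => v j.succ) := by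
  have h0 : HasFDerivAt (fun p : Fin (m + 1) → ℂ => L⁻¹ • (p 0 - z₀))
      (L⁻¹ • (ContinuousLinearMap.proj (R := ℝ) (φ := fun _ : Fin (m + 1) => ℂ) 0)) p :=
    ((hasFDerivAt_apply (𝕜 := ℝ) 0 p).sub_const z₀).const_smul L⁻¹
  have h1 : HasFDerivAt (fun (p : Fin (m + 1) → ℂ) (j : Fin m) => p j.succ)
      (ContinuousLinearMap.pi fun j : Fin m =>
        ContinuousLinearMap.proj (R := ℝ) (φ := fun _ : Fin (m + 1) => ℂ) j.succ) p :=
    hasFDerivAt_pi.2 fun j => hasFDerivAt_apply (𝕜 := ℝ) j.succ p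
  have h2 := ((hq (L⁻¹ • (p 0 - z₀))).hasFDerivAt.comp p h0).mul
    ((hb (fun j => p j.succ)).hasFDerivAt.comp p h1)
  have h3 := h2.fderiv
  simp only [Function.comp_def, Pi.mul_def] at h3
  rw [h3]
  simp
  ring

lemma dbarCoord_zero_scaled_mul_tail {m : ℕ} {q : ℂ → ℂ} (hq : Differentiable ℝ q)
    {b : (Fin m → ℂ) → ℂ} (hb : Differentiable ℝ b) (z₀ : ℂ) (L : ℝ) (p : Fin (m + 1) → ℂ) :
    dbarCoord (m + 1) (fun p => q (L⁻¹ • (p 0 - z₀)) * b (fun j => p j.succ)) 0 p =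
      L⁻¹ • wirtingerBar q (L⁻¹ • (p 0 - z₀)) * b (fun j => p j.succ) := by
  have h (c : ℂ) : (fun j : Fin m => (Pi.single 0 c : Fin (m + 1) → ℂ) j.succ) = 0 := by
    ext j; simp
  rw [dbarCoord, fderiv_scaled_mul_tail hq hb, fderiv_scaled_mul_tail hq hb, h, h]
  simp only [wirtingerBar, Pi.single_eq_same, map_zero, Complex.real_smul]
  ring

lemma dbarCoord_zero_scaled {m : ℕ} {q : ℂ → ℂ} (hq : Differentiable ℝ q) (z₀ : ℂ) (L : ℝ)
    (p : Fin (m + 1) → ℂ) :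
    dbarCoord (m + 1) (fun p => q (L⁻¹ • (p 0 - z₀))) 0 p =
      L⁻¹ • wirtingerBar q (L⁻¹ • (p 0 - z₀)) := by
  simpa using dbarCoord_zero_scaled_mul_tail hq (b := fun _ : Fin m → ℂ => 1)
    (differentiable_const _) z₀ L p

lemma dbarCoord_succ_scaled {m : ℕ} {q : ℂ → ℂ} (hq : Differentiable ℝ q) (z₀ : ℂ) (L : ℝ)
    (j : Fin m) (p : Fin (m + 1) → ℂ) :
    dbarCoord (m + 1) (fun p => q (L⁻¹ • (p 0 - z₀))) j.succ p = 0 := by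
  have h := fderiv_scaled_mul_tail hq (b := fun _ : Fin m → ℂ => 1)
    (differentiable_const _) z₀ L p
  simp only [mul_one] at h
  rw [dbarCoord, h, h]
  simp

/-- The polydisc with radius `R` in the first coordinate and radius `r` in the others. -/
def polydisc (m : ℕ) (z₀ : ℂ) (R r : ℝ) : Set (Fin (m + 1) → ℂ) :=
  Set.univ.pi (Fin.cons (closedBall z₀ R) fun _ => closedBall 0 r)

lemma mem_polydisc {m : ℕ} {z₀ : ℂ} {R r : ℝ} {p : Fin (m + 1) → ℂ} :
    p ∈ polydisc m z₀ R r ↔ p 0 ∈ closedBall z₀ R ∧ ∀ j : Fin m, p j.succ ∈ closedBall 0 r := by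
  rw [polydisc, Set.mem_univ_pi, Fin.forall_fin_succ]
  simp only [Fin.cons_zero, Fin.cons_succ]

lemma isCompact_polydisc (m : ℕ) (z₀ : ℂ) (R r : ℝ) : IsCompact (polydisc m z₀ R r) := by
  refine isCompact_univ_pi (Fin.cases ?_ fun j => ?_)
  · simpa only [Fin.cons_zero] using isCompact_closedBall z₀ R
  · simpa only [Fin.cons_succ] using isCompact_closedBall (0 : ℂ) r

lemma volume_polydisc_one (m : ℕ) (z₀ : ℂ) (R : ℝ) :
    volume (polydisc m z₀ R 1) = ENNReal.ofReal R ^ 2 * (NNReal.pi : ENNReal) ^ (m + 1) := by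
  rw [polydisc, volume_pi_pi, Fin.prod_univ_succ]
  simp only [Fin.cons_zero, Fin.cons_succ, Complex.volume_closedBall]
  simp only [ENNReal.ofReal_one, one_pow, one_mul, Finset.prod_const, Finset.card_univ,
    Fintype.card_fin]
  ring

/-- An `L²` bound for a bounded function vanishing off a polydisc. -/
lemma memLp_of_polydisc {m : ℕ} {Ω : Set (Fin (m + 1) → ℂ)} (hΩ : MeasurableSet Ω)
    {z₀ : ℂ} {R M : ℝ} (hR : 0 ≤ R) {f : (Fin (m + 1) → ℂ) → ℂ} (hf : Continuous f)
    (hM : ∀ p, ‖f p‖ ≤ M) (h0 : ∀ p ∈ Ω, p ∉ polydisc m z₀ R 1 → f p = 0) :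
    MemLp f 2 (volume.restrict Ω) ∧
      (eLpNorm f 2 (volume.restrict Ω)).toReal ≤ R * √(Real.pi ^ (m + 1)) * M := by
  have hM0 : 0 ≤ M := (norm_nonneg _).trans (hM 0)
  have hS := (isCompact_polydisc m z₀ R 1).isClosed.measurableSet
  have e : f =ᵐ[volume.restrict Ω] (polydisc m z₀ R 1).indicator f := by
    filter_upwards [ae_restrict_mem hΩ] with p hp
    by_cases h : p ∈ polydisc m z₀ R 1
    · rw [Set.indicator_of_mem h]
    · rw [Set.indicator_of_notMem h, h0 p hp h]
  have hle : eLpNorm f 2 (volume.restrict Ω) ≤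
      ENNReal.ofReal (R * √(Real.pi ^ (m + 1)) * M) := by
    rw [eLpNorm_congr_ae e, eLpNorm_indicator_eq_eLpNorm_restrict hS]
    calc eLpNorm f 2 ((volume.restrict Ω).restrict (polydisc m z₀ R 1))
        ≤ eLpNorm f 2 (volume.restrict (polydisc m z₀ R 1)) :=
          eLpNorm_mono_measure _ (Measure.restrict_mono le_rfl Measure.restrict_le_self)
      _ ≤ _ := eLpNorm_le_of_ae_bound (Filter.Eventually.of_forall hM)
      _ = _ := by
          rw [Measure.restrict_apply_univ, volume_polydisc_one,
            ENNReal.ofReal_mul (by positivity), ENNReal.ofReal_mul hR]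
          congr 1
          rw [ENNReal.mul_rpow_of_nonneg _ _ (by positivity), Real.sqrt_eq_rpow,
            ← ENNReal.ofReal_rpow_of_nonneg (by positivity) (by positivity),
            ENNReal.ofReal_pow Real.pi_pos.le, ← ENNReal.rpow_natCast, ← ENNReal.rpow_mul]
          rw [show (NNReal.pi : ENNReal) = ENNReal.ofReal Real.pi from
            (ENNReal.ofReal_coe_nnreal (p := NNReal.pi)).symm]
          norm_num
  exact ⟨⟨hf.aestronglyMeasurable, hle.trans_lt ENNReal.ofReal_lt_top⟩,
    ENNReal.toReal_le_of_le_ofReal (by positivity) hle⟩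

lemma contDiff_scaled {m : ℕ} {q : ℂ → ℂ} (hq : ContDiff ℝ ∞ q) (z₀ : ℂ) (L : ℝ) :
    ContDiff ℝ ∞ fun p : Fin (m + 1) → ℂ => q (L⁻¹ • (p 0 - z₀)) :=
  hq.comp (((contDiff_apply ℝ ℂ 0).sub contDiff_const).const_smul L⁻¹)

lemma inv_smul_sub_mem_closedBall_iff {z z₀ : ℂ} {L r : ℝ} (hL : 0 < L) :
    L⁻¹ • (z - z₀) ∈ closedBall 0 r ↔ z ∈ closedBall z₀ (L * r) := by
  rw [mem_closedBall_zero_iff, norm_smul, norm_inv, Real.norm_of_nonneg hL.le,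
    inv_mul_le_iff₀ hL, mem_closedBall_iff_norm]

/-- The integral of a rescaled function of the first coordinate times a product. -/
lemma integral_scaled_mul_prod (m : ℕ) (g ψ : ℂ → ℂ) (z₀ : ℂ) (L : ℝ) :
    ∫ p : Fin (m + 1) → ℂ, g (L⁻¹ • (p 0 - z₀)) * ∏ j : Fin m, ψ (p j.succ) =
      (L ^ 2 * ∫ z, g z) * (∫ z, ψ z) ^ m := by
  have h := integral_fintype_prod_volume_eq_prod (ι := Fin (m + 1)) (E := fun _ => ℂ)
    (Fin.cons (fun z => g (L⁻¹ • (z - z₀))) fun _ => ψ)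
  simp only [Fin.prod_univ_succ, Fin.cons_zero, Fin.cons_succ, Finset.prod_const,
    Finset.card_univ, Fintype.card_fin] at h
  rw [h, integral_sub_right_eq_self (fun z => g (L⁻¹ • z)), Measure.integral_comp_inv_smul]
  simp

/-- There are smooth `q`, `h`, compactly supported in the unit disc, with
`∫ (∂q/∂z̄) h = ∫ h > 0`. -/
lemma exists_pair_integral_wirtingerBar :
    ∃ q h : ℂ → ℂ, ContDiff ℝ ∞ q ∧ tsupport q ⊆ closedBall 0 1 ∧ ContDiff ℝ ∞ h ∧
      tsupport h ⊆ closedBall 0 (1 / 2) ∧ 0 < ‖∫ z, wirtingerBar q z * h z‖ := by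
  let η : ContDiffBump (0 : ℂ) := ⟨1 / 2, 1, by norm_num, by norm_num⟩
  let θ : ContDiffBump (0 : ℂ) := ⟨1 / 4, 1 / 2, by norm_num, by norm_num⟩
  have hη : tsupport (fun z => (η z : ℂ)) ⊆ closedBall 0 1 := by
    rw [← η.tsupport_eq]
    exact closure_mono fun z hz => by simpa using hz
  have hθ : tsupport (fun z => (θ z : ℂ)) ⊆ closedBall 0 (1 / 2) := by
    rw [← θ.tsupport_eq]
    exact closure_mono fun z hz => by simpa using hz
  refine ⟨fun z => η z * star z, fun z => θ z,
    (Complex.ofRealCLM.contDiff.comp η.contDiff).mul Complex.conjCLE.contDiff,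
    (tsupport_mul_subset_left (f := fun z => (η z : ℂ))).trans hη,
    Complex.ofRealCLM.contDiff.comp θ.contDiff, hθ, ?_⟩
  have e (z : ℂ) : wirtingerBar (fun z => η z * star z) z * θ z = (θ z : ℂ) := by
    by_cases hz : z ∈ ball (0 : ℂ) (1 / 2)
    · rw [wirtingerBar_eq_one, one_mul]
      filter_upwards [η.eventuallyEq_one_of_mem_ball hz] with w hw
      simp [hw]
    · rw [θ.zero_of_le_dist (not_lt.1 hz)]
      simp
  simp only [e]
  rw [integral_complex_ofReal, Complex.norm_real, Real.norm_of_nonneg θ.integral_pos.le]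
  exact θ.integral_pos

/-- There is a smooth `ψ` with `0 ≤ ψ ≤ 1`, supported in a given disc about `0`, whose integral
does not vanish. -/
lemma exists_cutoff {r : ℝ} (hr : 0 < r) :
    ∃ ψ : ℂ → ℂ, ContDiff ℝ ∞ ψ ∧ tsupport ψ ⊆ closedBall 0 r ∧ (∀ z, ‖ψ z‖ ≤ 1) ∧
      0 < ‖∫ z, ψ z‖ := by
  let θ : ContDiffBump (0 : ℂ) := ⟨r / 2, r, by linarith, by linarith⟩
  refine ⟨fun z => θ z, Complex.ofRealCLM.contDiff.comp θ.contDiff, ?_, fun z => ?_, ?_⟩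
  · rw [← θ.tsupport_eq]
    exact closure_mono fun z hz => by simpa using hz
  · rw [Complex.norm_real, Real.norm_of_nonneg θ.nonneg]
    exact θ.le_one
  · rw [integral_complex_ofReal, Complex.norm_real, Real.norm_of_nonneg θ.integral_pos.le]
    exact θ.integral_pos

/-- The tube over `D` with fibre the Euclidean unit ball. -/
def tube (D : Set ℂ) (m : ℕ) : Set (Fin (m + 1) → ℂ) :=
  {p | p 0 ∈ D ∧ ∑ j : Fin m, Complex.normSq (p j.succ) < 1}

lemma isOpen_tube {D : Set ℂ} (hD : IsOpen D) (m : ℕ) : IsOpen (tube D m) := by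
  have hc := Complex.continuous_normSq
  have h : IsOpen {p : Fin (m + 1) → ℂ | ∑ j : Fin m, Complex.normSq (p j.succ) < 1} :=
    isOpen_lt (by fun_prop) continuous_const
  exact (hD.preimage (continuous_apply 0)).inter h

lemma mem_closedBall_of_mem_tube {D : Set ℂ} {m : ℕ} {p : Fin (m + 1) → ℂ} (hp : p ∈ tube D m)
    (j : Fin m) : p j.succ ∈ closedBall 0 1 := by
  have h : Complex.normSq (p j.succ) ≤ ∑ j : Fin m, Complex.normSq (p j.succ) :=
    Finset.single_le_sum (f := fun j : Fin m => Complex.normSq (p j.succ))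
      (fun _ _ => Complex.normSq_nonneg _) (Finset.mem_univ j)
  have h2 := hp.2
  rw [Complex.normSq_eq_norm_sq] at h
  rw [mem_closedBall_zero_iff]
  nlinarith [norm_nonneg (p j.succ)]

lemma polydisc_subset_tube {D : Set ℂ} {m : ℕ} {z₀ : ℂ} {R : ℝ} (h : closedBall z₀ R ⊆ D) :
    polydisc m z₀ R (1 / (m + 1)) ⊆ tube D m := by
  intro p hp
  rw [mem_polydisc] at hp
  refine ⟨h hp.1, ?_⟩
  have hb (j : Fin m) : Complex.normSq (p j.succ) ≤ 1 / (m + 1) := by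
    have h1 := mem_closedBall_zero_iff.1 (hp.2 j)
    have h2 : (1 : ℝ) / (m + 1) ≤ 1 := by
      rw [div_le_one (by positivity)]
      linarith [Nat.cast_nonneg (α := ℝ) m]
    rw [Complex.normSq_eq_norm_sq]
    nlinarith [norm_nonneg (p j.succ)]
  calc ∑ j : Fin m, Complex.normSq (p j.succ) ≤ ∑ _j : Fin m, (1 : ℝ) / (m + 1) :=
        Finset.sum_le_sum fun j _ => hb j
    _ = m / (m + 1) := by simp [div_eq_mul_inv]
    _ < 1 := by rw [div_lt_one (by positivity)]; linarith

/-- If `∂̄u = α` can be solved on the tube with an `L²` bound, then the radii of the discs in the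
base are bounded. -/
lemma exists_radius_bound {D : Set ℂ} (hD : IsOpen D) (m : ℕ) {C : ℝ} (hC : 0 ≤ C)
    (H : ∀ (u : Lp ℂ 2 (volume.restrict (tube D m)))
      (α : Fin (m + 1) → Lp ℂ 2 (volume.restrict (tube D m))),
      DbarEq (m + 1) (tube D m) u (fun j => α j) →
      ∃ v : Lp ℂ 2 (volume.restrict (tube D m)),
        DbarEq (m + 1) (tube D m) v (fun j => α j) ∧ ‖v‖ ≤ C * ‖α‖) :
    ∃ B : ℝ, ∀ L > 0, ∀ z₀ : ℂ, ball z₀ L ⊆ D → L ≤ B := by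
  obtain ⟨q, h, hq, hqs, hh, hhs, hI⟩ := exists_pair_integral_wirtingerBar
  obtain ⟨ψ, hψ, hψs, hψ1, hJ⟩ := exists_cutoff (r := 1 / (m + 1)) (by positivity)
  have hqc : HasCompactSupport q :=
    (isCompact_closedBall (0 : ℂ) 1).of_isClosed_subset (isClosed_tsupport q) hqs
  have hhc : HasCompactSupport h :=
    (isCompact_closedBall (0 : ℂ) (1 / 2)).of_isClosed_subset (isClosed_tsupport h) hhs
  obtain ⟨M₀, hM₀⟩ := hqc.exists_bound_of_continuous hq.continuous
  obtain ⟨M₁, hM₁⟩ := exists_norm_wirtingerBar_le hq hqc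
  obtain ⟨M₂, hM₂⟩ := exists_norm_wirtingerBar_le hh hhc
  have hM₁0 : 0 ≤ M₁ := (norm_nonneg _).trans (hM₁ 0)
  have hM₂0 : 0 ≤ M₂ := (norm_nonneg _).trans (hM₂ 0)
  set I := ∫ z, wirtingerBar q z * h z with hIdef
  set J := ∫ z, ψ z with hJdef
  set κ := √(Real.pi ^ (m + 1)) with hκ
  refine ⟨(C * (κ * M₁) * (κ * M₂)) / (‖I‖ * ‖J‖ ^ m), fun L hL z₀ hLD => ?_⟩
  have hΩ := (isOpen_tube hD m).measurableSet
  have hoff {f : ℂ → ℂ} (hf : tsupport f ⊆ closedBall 0 1) {p : Fin (m + 1) → ℂ}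
      (hp : p ∈ tube D m) (hp' : p ∉ polydisc m z₀ L 1) : L⁻¹ • (p 0 - z₀) ∉ tsupport f := by
    intro hmem
    refine hp' (mem_polydisc.2 ⟨?_, mem_closedBall_of_mem_tube hp⟩)
    simpa using (inv_smul_sub_mem_closedBall_iff hL).1 (hf hmem)
  -- the solution `u` and its right-hand side
  let u : (Fin (m + 1) → ℂ) → ℂ := fun p => q (L⁻¹ • (p 0 - z₀))
  have hu : ContDiff ℝ ∞ u := contDiff_scaled hq z₀ L
  have hu2 : MemLp u 2 (volume.restrict (tube D m)) :=
    (memLp_of_polydisc hΩ hL.le hu.continuous (fun p => hM₀ _) fun p hp hp' =>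
      image_eq_zero_of_notMem_tsupport (f := q) (hoff hqs hp hp')).1
  have hα (j : Fin (m + 1)) := memLp_of_polydisc (M := L⁻¹ * M₁) (z₀ := z₀) hΩ hL.le
    (continuous_dbarCoord hu j)
    (by
      intro p
      refine Fin.cases ?_ (fun j => ?_) j
      · rw [dbarCoord_zero_scaled (hq.differentiable (by simp)), norm_smul, norm_inv,
          Real.norm_of_nonneg hL.le]
        exact mul_le_mul_of_nonneg_left (hM₁ _) (by positivity)
      · rw [dbarCoord_succ_scaled (hq.differentiable (by simp)), norm_zero]
        positivity)
    (by
      intro p hp hp'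
      refine Fin.cases ?_ (fun j => ?_) j
      · rw [dbarCoord_zero_scaled (hq.differentiable (by simp)),
          wirtingerBar_eq_zero (hoff hqs hp hp'), smul_zero]
      · rw [dbarCoord_succ_scaled (hq.differentiable (by simp))])
  obtain ⟨v, hv, hvC⟩ := H (hu2.toLp u) (fun j => (hα j).1.toLp _)
    ((dbarEq_of_contDiff (tube D m) hu).congr_ae hu2.coeFn_toLp.symm
      fun j => (hα j).1.coeFn_toLp.symm)
  have hαn : ‖fun j => (hα j).1.toLp (dbarCoord (m + 1) u j)‖ ≤ κ * M₁ := by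
    refine (pi_norm_le_iff_of_nonneg (by positivity)).2 fun j => ?_
    rw [Lp.norm_toLp]
    refine (hα j).2.trans (le_of_eq ?_)
    rw [hκ]
    field_simp
  -- the test function
  let b : (Fin m → ℂ) → ℂ := fun w => ∏ j, ψ (w j)
  have hb : ContDiff ℝ ∞ b := contDiff_prod fun j _ => hψ.comp (contDiff_apply ℝ ℂ j)
  have hb1 (w : Fin m → ℂ) : ‖b w‖ ≤ 1 := by
    rw [norm_prod]
    exact Finset.prod_le_one (fun _ _ => norm_nonneg _) fun _ _ => hψ1 _
  let φ : (Fin (m + 1) → ℂ) → ℂ := fun p => h (L⁻¹ • (p 0 - z₀)) * b (fun j => p j.succ)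
  have hφ0 : ∀ p ∉ polydisc m z₀ (L * (1 / 2)) (1 / (m + 1)), φ p = 0 := by
    intro p hp
    contrapose! hp
    have h1 := left_ne_zero_of_mul hp
    have h2 := Finset.prod_ne_zero_iff.1 (right_ne_zero_of_mul hp)
    exact mem_polydisc.2 ⟨(inv_smul_sub_mem_closedBall_iff hL).1 (hhs (subset_tsupport h h1)),
      fun j => hψs (subset_tsupport ψ (h2 j (Finset.mem_univ j)))⟩
  have hK := isCompact_polydisc m z₀ (L * (1 / 2)) (1 / (m + 1))
  have hφ : IsTest (m + 1) (tube D m) φ := by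
    refine ⟨(contDiff_scaled hh z₀ L).mul
      (hb.comp (contDiff_pi.2 fun j => contDiff_apply ℝ ℂ j.succ)),
      HasCompactSupport.intro hK hφ0, ?_⟩
    refine (closure_minimal (fun p hp => ?_) hK.isClosed).trans
      (polydisc_subset_tube ((closedBall_subset_ball (by linarith)).trans hLD))
    by_contra hp'
    exact hp (hφ0 p hp')
  have hφn := memLp_of_polydisc (M := L⁻¹ * M₂) (z₀ := z₀) hΩ hL.le
    (continuous_dbarCoord hφ.1 0)
    (by
      intro p
      rw [dbarCoord_zero_scaled_mul_tail (hh.differentiable (by simp))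
        (hb.differentiable (by simp)), norm_mul, norm_smul, norm_inv, Real.norm_of_nonneg hL.le]
      refine (mul_le_of_le_one_right (by positivity) (hb1 _)).trans ?_
      exact mul_le_mul_of_nonneg_left (hM₂ _) (by positivity))
    (by
      intro p hp hp'
      rw [dbarCoord_zero_scaled_mul_tail (hh.differentiable (by simp))
        (hb.differentiable (by simp)), wirtingerBar_eq_zero
        (hoff (hhs.trans (closedBall_subset_closedBall (by norm_num))) hp hp'),
        smul_zero, zero_mul])
  -- compare the two sides of the weak equation for `v`
  have hweak := hv 0 φ hφ
  have hlhs : ∫ p in tube D m, ((hα 0).1.toLp (dbarCoord (m + 1) u 0)) p * φ p =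
      L * I * J ^ m := by
    calc ∫ p in tube D m, ((hα 0).1.toLp (dbarCoord (m + 1) u 0)) p * φ p
        = ∫ p in tube D m, dbarCoord (m + 1) u 0 p * φ p :=
          integral_congr_ae (by filter_upwards [(hα 0).1.coeFn_toLp] with p hp; rw [hp])
      _ = ∫ p, dbarCoord (m + 1) u 0 p * φ p :=
          setIntegral_eq_integral_of_forall_compl_eq_zero fun p hp => by
            rw [image_eq_zero_of_notMem_tsupport fun h' => hp (hφ.2.2 h'), mul_zero]
      _ = ∫ p : Fin (m + 1) → ℂ, (fun z => (L : ℂ)⁻¹ * (wirtingerBar q z * h z))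
            (L⁻¹ • (p 0 - z₀)) * ∏ j : Fin m, ψ (p j.succ) := by
          refine integral_congr_ae (Filter.Eventually.of_forall fun p => ?_)
          beta_reduce
          rw [show dbarCoord (m + 1) u 0 p = _ from
            dbarCoord_zero_scaled (hq.differentiable (by simp)) z₀ L p]
          simp only [φ, b, Complex.real_smul, Complex.ofReal_inv]
          ring
      _ = L * I * J ^ m := by
          refine (integral_scaled_mul_prod m
            (fun z => (L : ℂ)⁻¹ * (wirtingerBar q z * h z)) ψ z₀ L).trans ?_
          rw [integral_const_mul, ← hIdef, ← hJdef]
          have : (L : ℂ) ≠ 0 := by exact_mod_cast hL.ne'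
          field_simp
  have hfin : L * ‖I‖ * ‖J‖ ^ m ≤ C * (κ * M₁) * (κ * M₂) := by
    calc L * ‖I‖ * ‖J‖ ^ m = ‖(L : ℂ) * I * J ^ m‖ := by
          rw [norm_mul, norm_mul, norm_pow, Complex.norm_real, Real.norm_of_nonneg hL.le]
      _ = ‖∫ p in tube D m, v p * dbarCoord (m + 1) φ 0 p‖ := by
          rw [← hlhs, hweak, norm_neg]
      _ ≤ ‖v‖ * (eLpNorm (dbarCoord (m + 1) φ 0) 2 (volume.restrict (tube D m))).toReal :=
          norm_integral_mul_le hφn.1 v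
      _ ≤ (C * (κ * M₁)) * (κ * M₂) := by
          refine mul_le_mul (hvC.trans (mul_le_mul_of_nonneg_left hαn hC)) (hφn.2.trans ?_)
            ENNReal.toReal_nonneg (by positivity)
          rw [hκ]
          refine le_of_eq ?_
          field_simp
  rw [le_div_iff₀ (by positivity)]
  linarith

/-- **Large discs in the base obstruct closed range on a tube.** Let `D ⊆ ℂ` be a domain
containing arbitrarily large discs, `m ≥ 1`, and
`Ω = {(z,w) ∈ ℂ × ℂᵐ : z ∈ D, |w| < 1} ⊆ ℂ^{m+1}`. Then `∂̄` does not have closed range on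
`L²_{0,1}(Ω)`: the set `R(∂̄)` is not closed in `(L²(Ω))^{m+1}`. -/
theorem not_closed_range_tube
    (D : Set ℂ) (hne : D.Nonempty) (hop : IsOpen D) (hconn : IsConnected D)
    (hbig : ∀ L > 0, ∃ z : ℂ, Metric.ball z L ⊆ D)
    (m : ℕ) (hm : 1 ≤ m) :
    ¬ IsClosed {α : Fin (m + 1) →
        Lp ℂ 2 ((volume : Measure (Fin (m + 1) → ℂ)).restrict
          {p : Fin (m + 1) → ℂ | p 0 ∈ D ∧ ∑ j : Fin m, Complex.normSq (p j.succ) < 1}) |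
      ∃ u : Lp ℂ 2 ((volume : Measure (Fin (m + 1) → ℂ)).restrict
          {p : Fin (m + 1) → ℂ | p 0 ∈ D ∧ ∑ j : Fin m, Complex.normSq (p j.succ) < 1}),
        DbarEq (m + 1)
          {p : Fin (m + 1) → ℂ | p 0 ∈ D ∧ ∑ j : Fin m, Complex.normSq (p j.succ) < 1}
          (⇑u) (fun j => ⇑(α j))} := by
  intro hcl
  obtain ⟨C, hC, H⟩ := exists_norm_le_of_isClosed_range hcl
  obtain ⟨B, hB⟩ := exists_radius_bound hop m hC.le H
  obtain ⟨z₀, hz₀⟩ := hbig (|B| + 1) (by positivity)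
  linarith [hB _ (by positivity) z₀ hz₀, le_abs_self B]
end
end
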